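/- Let G = ℝ^{n+1} be a Grushin space of homogeneous dimension Q = n+2 with Q ≥ 4, and let B_R^Q(o) be the gauge ball of radius R > 0. Let 1 < p < ∞, p ≤ b < ∞, and a ≤ Q. Then for any u ∈ C_0^∞(B_R^Q(o)): ∫_{B_R^Q(o)} |∇_{ϱ,G} u|^p / ( ϱ^{a−p} (ln(R/ϱ))^{b−p} ) dx dt ≥ ((b−1)/p)^p ∫_{B_R^Q(o)} |u|^p ψ^{p/2} / ( ϱ^{a} (ln(R/ϱ))^{b} ) dx dt, and the constant ((b−1)/p)^p is sharp. -/

import Mathlib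

open MeasureTheory Real

noncomputable section

/-- Points of the Grushin space `ℝ^{n+1}`. -/
abbrev GPt (n : ℕ) := EuclideanSpace ℝ (Fin n) × ℝ

/-- Homogeneous Grushin norm `ϱ(x,t) = (|x|⁴ + 4t²)^{1/4}`. -/
def gNorm {n : ℕ} (z : GPt n) : ℝ := (‖z.1‖ ^ 4 + 4 * z.2 ^ 2) ^ ((1 : ℝ) / 4)

/-- The geometric term `ψ(x,t) = |x|²/ϱ²` (so that `|∇_G ϱ| = ψ^{1/2}`). -/
def gPsi {n : ℕ} (z : GPt n) : ℝ := ‖z.1‖ ^ 2 / gNorm z ^ 2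

/-- Radial derivative `∂_ϱ u(x,t) = d/ds u(s·x/ϱ, s²·t/ϱ²)` at `s = ϱ(x,t)`. -/
def radialDeriv {n : ℕ} (u : GPt n → ℝ) (z : GPt n) : ℝ :=
  deriv (fun s : ℝ => u ((s / gNorm z) • z.1, (s ^ 2 / gNorm z ^ 2) * z.2)) (gNorm z)

/-- The scaled function `u_R(x,t) = u(R·x/ϱ, R²·t/ϱ²)`. -/
def uScaled {n : ℕ} (R : ℝ) (u : GPt n → ℝ) (z : GPt n) : ℝ :=
  u ((R / gNorm z) • z.1, (R ^ 2 / gNorm z ^ 2) * z.2)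

/-- Radial Grushin operator `L_{ϱ,G} u = ψ(∂_ϱ² u + ((Q−1)/ϱ) ∂_ϱ u)`. -/
def radialLap {n : ℕ} (Q : ℝ) (u : GPt n → ℝ) (z : GPt n) : ℝ :=
  gPsi z * (radialDeriv (radialDeriv u) z + (Q - 1) / gNorm z * radialDeriv u z)

/-- The Grushin operator `L_G u = Δ_x u + |x|² ∂_t² u`. -/
def grushinOp {n : ℕ} (u : GPt n → ℝ) (z : GPt n) : ℝ :=
  (∑ i : Fin n,
      deriv (deriv fun s : ℝ => u (z.1 + s • EuclideanSpace.single i (1 : ℝ), z.2)) 0)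
    + ‖z.1‖ ^ 2 * deriv (deriv fun s : ℝ => u (z.1, z.2 + s)) 0

/-- The first-order operator `T_β(u) = ψ^{1/2}(∂_ϱ u + ((Q−β−2)/(2ϱ)) u)`. -/
def Tweight {n : ℕ} (Q β : ℝ) (u : GPt n → ℝ) (z : GPt n) : ℝ :=
  Real.sqrt (gPsi z) * (radialDeriv u z + (Q - β - 2) / (2 * gNorm z) * u z)

/-- The iterated operator `R_{β,k} = T_β ∘ T_{β+2} ∘ ⋯ ∘ T_{β+2k}`. -/
def Rop {n : ℕ} (Q : ℝ) : ℕ → ℝ → (GPt n → ℝ) → GPt n → ℝ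
  | 0, β, u => Tweight Q β u
  | k + 1, β, u => Tweight Q β (Rop Q k (β + 2) u)

/-- The constants `Λ_k(Q,p,β)`. -/
def Lam (Q p β : ℝ) (k : ℕ) : ℝ :=
  if k = 1 then ((Q - p - β) / p) ^ p
  else ((Q * (p - 1) + β + ((k : ℝ) - 2) * p) * (Q - β - (k : ℝ) * p) / p ^ 2) ^ p

/-- The constant `C_{2l,p,β} = ∏_{i=1}^{l} Λ_{2i}(Q,p,β)`. -/
def Ceven (Q p β : ℝ) (l : ℕ) : ℝ := ∏ i ∈ Finset.range l, Lam Q p β (2 * i + 2)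

/-- The constant `C_{2l+1,p,β} = ∏_{i=0}^{l} Λ_{2i+1}(Q,p,β)`. -/
def Codd (Q p β : ℝ) (l : ℕ) : ℝ := ∏ i ∈ Finset.range (l + 1), Lam Q p β (2 * i + 1)

/-- The constant `A_m = ((Q+m)² + (Q−4−m)²)/4`. -/
def Aconst (Q m : ℝ) : ℝ := ((Q + m) ^ 2 + (Q - 4 - m) ^ 2) / 4

/-- The constants `D_{j,m,β}` given by the iteration
`D_{j,m+1,β} = Λ_{2m+2}(Q,2,β) D_{j−2,m,β} + A_{β+4m} D_{j−1,m,β} + D_{j,m,β}`,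
with `D_{0,0,β} = 1` (and vanishing off-range values). -/
def Dconst (Q β : ℝ) : ℕ → ℤ → ℝ
  | 0, j => if j = 0 then 1 else 0
  | m + 1, j =>
      Lam Q 2 β (2 * m + 2) * Dconst Q β m (j - 2)
        + Aconst Q (β + 4 * (m : ℝ)) * Dconst Q β m (j - 1) + Dconst Q β m j

/-- The constants `B_{j,m,β,k}` given by the iteration
`B_{j,m+1,β,k} = Λ_2(Q,2,β+2k+2) B_{j−2,m,β+4,k} + A_{β+2k+2} B_{j−1,m,β+2,k+1} + B_{j,m,β,k+2}`,
with `B_{0,0,β,k} = 1` (and vanishing off-range values). -/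
def Bconst (Q : ℝ) : ℕ → ℤ → ℝ → ℝ → ℝ
  | 0, j, _, _ => if j = 0 then 1 else 0
  | m + 1, j, β, k =>
      Lam Q 2 (β + 2 * k + 2) 2 * Bconst Q m (j - 2) (β + 4) k
        + Aconst Q (β + 2 * k + 2) * Bconst Q m (j - 1) (β + 2) (k + 1)
        + Bconst Q m j β (k + 2)

/-- Surface measure `ω_n` of the unit sphere in `ℝ^n`. -/
def sphSurface (n : ℕ) : ℝ :=
  n * (volume (Metric.ball (0 : EuclideanSpace ℝ (Fin n)) 1)).toReal

/-- The integral constant `C^{Ω,m} = ω_n ∫_0^π (sin φ)^{(n+m)/2} dφ`. -/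
def COmega (n m : ℕ) : ℝ :=
  sphSurface n * ∫ φ in (0 : ℝ)..π, Real.sin φ ^ (((n : ℝ) + (m : ℝ)) / 2)

/-- The sharp Frank–Seiringer constant `c_p = min_{0<t≤1/2} [(1−t)^p − t^p + p t^{p−1}]`. -/
def cFS (p : ℝ) : ℝ :=
  sInf {y : ℝ | ∃ t : ℝ, 0 < t ∧ t ≤ 1 / 2 ∧ y = (1 - t) ^ p - t ^ p + p * t ^ (p - 1)}

/-- Compactly supported smooth test functions with (closed) support inside `s`. -/
def IsTest {n : ℕ} (s : Set (GPt n)) (u : GPt n → ℝ) : Prop :=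
  ContDiff ℝ (⊤ : ℕ∞) u ∧ HasCompactSupport u ∧ tsupport u ⊆ s

/-- A function on the Grushin space is radial if it depends only on the homogeneous norm. -/
def IsRadial {n : ℕ} (u : GPt n → ℝ) : Prop :=
  ∃ f : ℝ → ℝ, ∀ z, u z = f (gNorm z)

/-- The distance function `d_H(u,R)`. -/
def dH {n : ℕ} (Q p β R : ℝ) (u : GPt n → ℝ) : ℝ :=
  (∫ z : GPt n,
      |u z - R ^ ((Q - p - β) / p) * uScaled R u z * gNorm z ^ (-((Q - p - β) / p))| ^ p *
        gPsi z ^ (p / 2) / (|Real.log (R / gNorm z)| ^ p * gNorm z ^ (p + β))) ^ (1 / p)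

/-- The distance function `d_R(u,k,β)`. -/
def dRdist {n : ℕ} (Q p β R : ℝ) (k : ℕ) (u : GPt n → ℝ) : ℝ :=
  (∫ z : GPt n,
      (|u z| ^ ((p - 2) / 2) * u z -
          |uScaled R u z| ^ ((p - 2) / 2) * uScaled R u z *
            (gNorm z / R) ^ (-((Q - (k : ℝ) * p - β) / 2))) ^ 2 *
        gPsi z ^ (p / 2) /
        (gNorm z ^ ((k : ℝ) * p + β) * Real.log (R / gNorm z) ^ 2)) ^ ((1 : ℝ) / 2)

/-- The distance function `d_C(u,R)`. -/
def dCdist {n : ℕ} (Q p R : ℝ) (u : GPt n → ℝ) : ℝ :=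
  (∫ z in {z : GPt n | gNorm z < 1},
      |u z - Real.log (1 / gNorm z) ^ ((p - 1) / p) * R ^ ((p - 1) / p) *
          uScaled (Real.exp (-1 / R)) u z| ^ p *
        gPsi z ^ (p / 2) /
        (gNorm z ^ Q * Real.log (1 / gNorm z) ^ p *
          |Real.log (R * Real.log (1 / gNorm z))| ^ p)) ^ (1 / p)

/-- Young's inequality in the form of the tangent-line bound for the `p`-th power. -/
theorem mul_rpow_sub_one_le {p A B : ℝ} (hp : 1 < p) (hA : 0 ≤ A) (hB : 0 ≤ B) :
    p * (A * B ^ (p - 1)) ≤ A ^ p + (p - 1) * B ^ p := by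
  have hpq : p.HolderConjugate (p / (p - 1)) := Real.HolderConjugate.conjExponent hp
  have h := Real.young_inequality_of_nonneg hA (Real.rpow_nonneg hB (p - 1)) hpq
  have hp1 : p - 1 ≠ 0 := by linarith
  have hp0 : p ≠ 0 := by linarith
  rw [← Real.rpow_mul hB, mul_div_cancel₀ _ hp1] at h
  calc p * (A * B ^ (p - 1)) ≤ p * (A ^ p / p + B ^ p / (p / (p - 1))) := by
        gcongr
    _ = A ^ p + (p - 1) * B ^ p := by field_simp

/-- Pointwise form of the one-dimensional Hardy inequality. -/
theorem hardy_pointwise {p b α x y s : ℝ} (hp : 1 < p) (hpb : p ≤ b) (hα : 0 ≤ α) (hs : 0 < s) :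
    ((b - 1) / p) ^ (p - 1) *
      ((p * |x| ^ (p - 2) * x * y * s ^ (1 - b) + |x| ^ p * ((1 - b) * s ^ (1 - b - 1)))
          * exp (-α * s) + |x| ^ p * s ^ (1 - b) * (exp (-α * s) * -α)) ≤
    |y| ^ p * exp (-α * s) * s ^ (p - b) -
      ((b - 1) / p) ^ p * (|x| ^ p * exp (-α * s) * s ^ (-b)) := by
  have hp0 : 0 < p := by linarith
  set c := (b - 1) / p with hc
  have hc0 : 0 < c := div_pos (by linarith) hp0
  have hX : p * |x| ^ (p - 2) * x * y ≤ p * (|x| ^ (p - 1) * |y|) := by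
    rcases eq_or_ne x 0 with rfl | hx
    · simp; positivity
    · have hx' : 0 < |x| := abs_pos.2 hx
      have : |x| ^ (p - 1) = |x| ^ (p - 2) * |x| := by
        rw [← Real.rpow_add_one hx'.ne']; congr 1; ring
      rw [this]
      have h2 : x * y ≤ |x| * |y| := by rw [← abs_mul]; exact le_abs_self _
      have h3 : 0 ≤ p * |x| ^ (p - 2) := by positivity
      nlinarith [mul_le_mul_of_nonneg_left h2 h3]
  have hY := mul_rpow_sub_one_le (A := |y|) (B := c * |x| / s) hp (abs_nonneg y) (by positivity)
  rw [Real.div_rpow (by positivity) hs.le, Real.mul_rpow hc0.le (abs_nonneg x),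
    Real.div_rpow (by positivity) hs.le, Real.mul_rpow hc0.le (abs_nonneg x)] at hY
  have e1 : s ^ (1 - b) = s ^ (p - b) / s ^ (p - 1) := by
    rw [← Real.rpow_sub hs]; congr 1; ring
  have e2 : s ^ (-b) = s ^ (p - b) / s ^ p := by
    rw [← Real.rpow_sub hs]; congr 1; ring
  have e3 : s ^ (1 - b - 1) = s ^ (-b) := by congr 1; ring
  have e4 : c ^ (p - 1) * (b - 1) = p * c ^ p := by
    have : c ^ p = c ^ (p - 1) * c := by
      rw [← Real.rpow_add_one hc0.ne']; congr 1; ring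
    rw [this, hc]; field_simp
  have hw : 0 ≤ exp (-α * s) := (exp_pos _).le
  have hS : 0 ≤ s ^ (p - b) := Real.rpow_nonneg hs.le _
  have key : c ^ (p - 1) * (p * |x| ^ (p - 2) * x * y) * s ^ (1 - b) ≤
      |y| ^ p * s ^ (p - b) + (p - 1) * c ^ p * |x| ^ p * s ^ (-b) := by
    calc c ^ (p - 1) * (p * |x| ^ (p - 2) * x * y) * s ^ (1 - b)
        ≤ c ^ (p - 1) * (p * (|x| ^ (p - 1) * |y|)) * s ^ (1 - b) := by
          gcongr
      _ = p * (|y| * (c ^ (p - 1) * |x| ^ (p - 1) / s ^ (p - 1))) * s ^ (p - b) := by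
          rw [e1]; ring
      _ ≤ (|y| ^ p + (p - 1) * (c ^ p * |x| ^ p / s ^ p)) * s ^ (p - b) := by
          gcongr
      _ = _ := by rw [e2]; ring
  have hΦ : 0 ≤ c ^ (p - 1) * (|x| ^ p * s ^ (1 - b)) * exp (-α * s) * α := by positivity
  rw [e3]
  have key2 := mul_le_mul_of_nonneg_right key hw
  have e5 : c ^ (p - 1) * (|x| ^ p * ((1 - b) * s ^ (-b))) * exp (-α * s) =
      - (p * c ^ p) * |x| ^ p * s ^ (-b) * exp (-α * s) := by
    rw [← e4]; ring
  nlinarith [key2, hΦ, e5]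

/-- The one-dimensional Hardy inequality on a compact interval, where the left end point
carries no boundary term. -/
theorem hardy_integral_Icc {p b α s₀ N : ℝ} {h : ℝ → ℝ} (hp : 1 < p) (hpb : p ≤ b) (hα : 0 ≤ α)
    (hs₀ : 0 < s₀) (hN : s₀ ≤ N) (hd : Differentiable ℝ h) (hc : Continuous (deriv h))
    (h0 : h s₀ = 0) :
    ∫⁻ s in Set.Ioc s₀ N, ENNReal.ofReal
        (((b - 1) / p) ^ p * (|h s| ^ p * exp (-α * s) * s ^ (-b))) ≤
    ∫⁻ s in Set.Ioc s₀ N, ENNReal.ofReal (|deriv h s| ^ p * exp (-α * s) * s ^ (p - b)) := by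
  have hp0 : 0 < p := by linarith
  have hc0 : 0 < (b - 1) / p := div_pos (by linarith) hp0
  have hpos : ∀ s ∈ Set.Icc s₀ N, s ≠ 0 := fun s hs => (hs₀.trans_le hs.1).ne'
  have hrp : ∀ q : ℝ, ContinuousOn (fun s : ℝ => s ^ q) (Set.Icc s₀ N) := fun q =>
    ContinuousOn.rpow_const continuousOn_id fun s hs => Or.inl (hpos s hs)
  have hex : Continuous fun s : ℝ => exp (-α * s) := by fun_prop
  have hhp : Continuous fun s => |h s| ^ p :=
    hd.continuous.abs.rpow_const fun s => Or.inr hp0.le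
  have hdp : Continuous fun s => |deriv h s| ^ p :=
    hc.abs.rpow_const fun s => Or.inr hp0.le
  have hcR : ContinuousOn (fun s => ((b - 1) / p) ^ p * (|h s| ^ p * exp (-α * s) * s ^ (-b)))
      (Set.Icc s₀ N) :=
    continuousOn_const.mul ((hhp.mul hex).continuousOn.mul (hrp _))
  have hcL : ContinuousOn (fun s => |deriv h s| ^ p * exp (-α * s) * s ^ (p - b))
      (Set.Icc s₀ N) := (hdp.mul hex).continuousOn.mul (hrp _)
  have hiR := hcR.integrableOn_Icc (μ := volume)
  have hiL := hcL.integrableOn_Icc (μ := volume)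
  have ftc := intervalIntegral.sub_le_integral_of_hasDeriv_right_of_le hN
    (g := fun s => ((b - 1) / p) ^ (p - 1) * (|h s| ^ p * s ^ (1 - b) * exp (-α * s)))
    (continuousOn_const.mul ((hhp.continuousOn.mul (hrp _)).mul hex.continuousOn))
    (fun s hs => by
      have hs0 : s ≠ 0 := hpos s ⟨hs.1.le, hs.2.le⟩
      have d1 := (hasDerivAt_abs_rpow (h s) hp).comp s (hd s).hasDerivAt
      have d2 := Real.hasDerivAt_rpow_const (x := s) (p := 1 - b) (Or.inl hs0)
      have d3 : HasDerivAt (fun s : ℝ => exp (-α * s)) (exp (-α * s) * -α) s := by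
        simpa using ((hasDerivAt_id s).const_mul (-α)).exp
      exact (((d1.mul d2).mul d3).const_mul _).hasDerivWithinAt)
    (hiL.sub hiR)
    (fun s hs => hardy_pointwise hp hpb hα (hs₀.trans hs.1))
  rw [intervalIntegral.integral_of_le hN] at ftc
  have hiL' := hiL.mono_set Set.Ioc_subset_Icc_self
  have hiR' := hiR.mono_set Set.Ioc_subset_Icc_self
  simp only [Pi.sub_apply] at ftc
  rw [integral_sub hiL' hiR'] at ftc
  have nonneg : ∀ (q r : ℝ) (x : ℝ), ∀ s ∈ Set.Ioc s₀ N, 0 ≤ |x| ^ q * exp (-α * s) * s ^ r :=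
    fun q r x s hs => by
      have : 0 < s := hs₀.trans hs.1
      positivity
  rw [← ofReal_integral_eq_lintegral_ofReal hiR', ← ofReal_integral_eq_lintegral_ofReal hiL']
  · apply ENNReal.ofReal_le_ofReal
    have hN0 : 0 < N := hs₀.trans_le hN
    have e0 : |h s₀| ^ p = 0 := by rw [h0, abs_zero, Real.zero_rpow hp0.ne']
    rw [e0] at ftc
    have : 0 ≤ ((b - 1) / p) ^ (p - 1) * (|h N| ^ p * N ^ (1 - b) * exp (-α * N)) := by positivity
    linarith
  · exact (ae_restrict_mem measurableSet_Ioc).mono fun s hs => nonneg _ _ _ s hs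
  · exact (ae_restrict_mem measurableSet_Ioc).mono fun s hs =>
      mul_nonneg (by positivity) (nonneg _ _ _ s hs)

/-- The weighted Hardy inequality on the half-line for functions vanishing near the origin. -/
theorem hardy_lintegral_Ioi {p b α s₀ : ℝ} {h : ℝ → ℝ} (hp : 1 < p) (hpb : p ≤ b) (hα : 0 ≤ α)
    (hs₀ : 0 < s₀) (hd : Differentiable ℝ h) (hc : Continuous (deriv h))
    (h0 : ∀ s ≤ s₀, h s = 0) :
    ENNReal.ofReal (((b - 1) / p) ^ p) *
      ∫⁻ s in Set.Ioi 0, ENNReal.ofReal (|h s| ^ p * exp (-α * s) * s ^ (-b)) ≤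
    ∫⁻ s in Set.Ioi 0, ENNReal.ofReal (|deriv h s| ^ p * exp (-α * s) * s ^ (p - b)) := by
  have hp0 : 0 < p := by linarith
  have hc0 : 0 ≤ ((b - 1) / p) ^ p := Real.rpow_nonneg (div_nonneg (by linarith) hp0.le) _
  rw [← lintegral_const_mul' _ _ ENNReal.ofReal_ne_top]
  simp_rw [← ENNReal.ofReal_mul hc0]
  have hU : Set.Ioi (0 : ℝ) = Set.Ioc 0 s₀ ∪ ⋃ N : ℕ, Set.Ioc s₀ (s₀ + N) := by
    ext s
    simp only [Set.mem_Ioi, Set.mem_union, Set.mem_Ioc, Set.mem_iUnion]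
    constructor
    · intro hs
      by_cases h : s ≤ s₀
      · exact Or.inl ⟨hs, h⟩
      · obtain ⟨N, hN⟩ := exists_nat_ge (s - s₀)
        exact Or.inr ⟨N, not_le.1 h, by linarith⟩
    · rintro (h | ⟨N, h⟩)
      · exact h.1
      · exact hs₀.trans h.1
  have hmono : Monotone fun N : ℕ => Set.Ioc s₀ (s₀ + N) := fun i j hij =>
    Set.Ioc_subset_Ioc_right (by gcongr)
  have hz : ∫⁻ s in Set.Ioc 0 s₀, ENNReal.ofReal
      (((b - 1) / p) ^ p * (|h s| ^ p * exp (-α * s) * s ^ (-b))) = 0 := by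
    rw [setLIntegral_congr_fun (g := fun _ => 0) measurableSet_Ioc]
    · simp
    · intro s hs
      simp [h0 s hs.2, Real.zero_rpow hp0.ne']
  conv_lhs => rw [hU]
  refine (lintegral_union_le _ _ _).trans ?_
  rw [hz, zero_add, setLIntegral_iUnion_of_directed _ hmono.directed_le]
  refine iSup_le fun N => ?_
  refine (hardy_integral_Icc hp hpb hα hs₀ (by simp) hd hc (h0 _ le_rfl)).trans ?_
  exact lintegral_mono_set fun s hs => hs₀.trans hs.1

/-- The anisotropic dilation `δ_r(x,t) = (r x, r² t)`. -/
def gDil {n : ℕ} (r : ℝ) (z : GPt n) : GPt n := (r • z.1, r ^ 2 * z.2)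

/-- The fundamental shell `{1 ≤ ϱ < e}` for the dilations. -/
def gShell (n : ℕ) : Set (GPt n) := {w | 1 ≤ gNorm w ∧ gNorm w < exp 1}

theorem continuous_gNorm {n : ℕ} : Continuous (gNorm : GPt n → ℝ) := by
  unfold gNorm
  exact Continuous.rpow_const (by fun_prop) fun _ => Or.inr (by norm_num)

theorem gNorm_nonneg {n : ℕ} (z : GPt n) : 0 ≤ gNorm z := Real.rpow_nonneg (by positivity) _

theorem gNorm_pow_four {n : ℕ} (z : GPt n) : gNorm z ^ 4 = ‖z.1‖ ^ 4 + 4 * z.2 ^ 2 := by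
  unfold gNorm
  rw [← Real.rpow_natCast, ← Real.rpow_mul (by positivity)]
  norm_num

theorem gNorm_base_pos {n : ℕ} {z : GPt n} (hz : z ≠ 0) : 0 < ‖z.1‖ ^ 4 + 4 * z.2 ^ 2 := by
  by_contra h
  have h1 : 0 ≤ ‖z.1‖ ^ 4 := by positivity
  have h2 : 0 ≤ z.2 ^ 2 := by positivity
  have h3 : ‖z.1‖ ^ 4 = 0 := by linarith
  have h4 : z.2 ^ 2 = 0 := by linarith
  exact hz (Prod.ext (norm_eq_zero.1 (pow_eq_zero_iff (by norm_num) |>.1 h3))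
    (pow_eq_zero_iff (by norm_num) |>.1 h4))

theorem gNorm_pos {n : ℕ} {z : GPt n} (hz : z ≠ 0) : 0 < gNorm z :=
  Real.rpow_pos_of_pos (gNorm_base_pos hz) _

theorem gNorm_zero {n : ℕ} : gNorm (0 : GPt n) = 0 := by
  simp [gNorm]

theorem norm_fst_le_gNorm {n : ℕ} (z : GPt n) : ‖z.1‖ ≤ gNorm z := by
  refine le_of_pow_le_pow_left₀ (n := 4) (by norm_num) (gNorm_nonneg z) ?_
  rw [gNorm_pow_four]
  nlinarith [sq_nonneg z.2]

theorem two_mul_abs_snd_le_gNorm_sq {n : ℕ} (z : GPt n) : 2 * |z.2| ≤ gNorm z ^ 2 := by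
  refine le_of_pow_le_pow_left₀ (n := 2) (by norm_num) (by positivity) ?_
  rw [← pow_mul, gNorm_pow_four, mul_pow, sq_abs]
  have : 0 ≤ ‖z.1‖ ^ 4 := by positivity
  linarith

theorem gNorm_gDil {n : ℕ} {r : ℝ} (hr : 0 ≤ r) (z : GPt n) :
    gNorm (gDil r z) = r * gNorm z := by
  have h : (‖(gDil r z).1‖ ^ 4 + 4 * (gDil r z).2 ^ 2) = r ^ 4 * (‖z.1‖ ^ 4 + 4 * z.2 ^ 2) := by
    simp only [gDil, norm_smul, Real.norm_eq_abs, abs_of_nonneg hr]; ring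
  unfold gNorm
  rw [h, Real.mul_rpow (by positivity) (by positivity), ← Real.rpow_natCast r 4,
    ← Real.rpow_mul hr]
  norm_num

theorem gPsi_gDil {n : ℕ} {r : ℝ} (hr : 0 < r) (z : GPt n) : gPsi (gDil r z) = gPsi z := by
  unfold gPsi
  rw [gNorm_gDil hr.le]
  simp only [gDil, norm_smul, Real.norm_eq_abs, abs_of_pos hr, mul_pow]
  rw [mul_div_mul_left _ _ (by positivity)]

theorem gDil_gDil {n : ℕ} (r s : ℝ) (z : GPt n) : gDil r (gDil s z) = gDil (r * s) z := by
  ext <;> simp [gDil, mul_assoc, mul_pow]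

theorem gDil_one {n : ℕ} (z : GPt n) : gDil 1 z = z := by
  simp [gDil]

theorem gPsi_nonneg {n : ℕ} (z : GPt n) : 0 ≤ gPsi z := by unfold gPsi; positivity

theorem gPsi_le_one {n : ℕ} (z : GPt n) : gPsi z ≤ 1 := by
  unfold gPsi
  exact div_le_one_of_le₀ (pow_le_pow_left₀ (norm_nonneg _) (norm_fst_le_gNorm z) 2)
    (by positivity)

theorem measurable_gPsi {n : ℕ} : Measurable (gPsi : GPt n → ℝ) := by
  unfold gPsi
  exact (measurable_fst.norm.pow_const 2).div (continuous_gNorm.measurable.pow_const 2)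

theorem measurableSet_gShell (n : ℕ) : MeasurableSet (gShell n) :=
  (measurableSet_le measurable_const continuous_gNorm.measurable).inter
    (measurableSet_lt continuous_gNorm.measurable measurable_const)

theorem gNorm_pos_of_mem_gShell {n : ℕ} {w : GPt n} (hw : w ∈ gShell n) : 0 < gNorm w :=
  zero_lt_one.trans_le hw.1

theorem isBounded_gNorm_le {n : ℕ} (r : ℝ) :
    Bornology.IsBounded {z : GPt n | gNorm z ≤ r} := by
  refine (Metric.isBounded_closedBall (x := (0 : GPt n)) (r := max r (r ^ 2))).subset ?_
  intro z (hz : gNorm z ≤ r)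
  rw [mem_closedBall_zero_iff, Prod.norm_def]
  have h2 := two_mul_abs_snd_le_gNorm_sq z
  have h3 := pow_le_pow_left₀ (gNorm_nonneg z) hz 2
  have h4 := abs_nonneg z.2
  refine max_le_max ((norm_fst_le_gNorm z).trans hz) ?_
  rw [Real.norm_eq_abs]
  linarith

instance isAddHaarMeasure_volume_GPt (n : ℕ) :
    (volume : Measure (GPt n)).IsAddHaarMeasure :=
  inferInstanceAs
    (((volume : Measure (EuclideanSpace ℝ (Fin n))).prod (volume : Measure ℝ)).IsAddHaarMeasure)

/-- The behaviour of Lebesgue measure under the anisotropic dilations. -/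
theorem lintegral_gDil {n : ℕ} {r : ℝ} (hr : 0 < r) {F : GPt n → ENNReal} (hF : Measurable F) :
    ∫⁻ z, F z = ∫⁻ z, ENNReal.ofReal (r ^ (n + 2)) * F (gDil r z) := by
  let f : GPt n →ₗ[ℝ] GPt n :=
    LinearMap.prodMap (r • LinearMap.id) ((r ^ 2) • LinearMap.id)
  have hfdet : LinearMap.det f = r ^ (n + 2) := by
    simp [f, LinearMap.det_prodMap, LinearMap.det_smul, pow_add]
  have hf0 : LinearMap.det f ≠ 0 := by rw [hfdet]; positivity
  have hmeas : Measurable f := f.continuous_of_finiteDimensional.measurable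
  have hfe : ∀ z, f z = gDil r z := fun z => by simp [f, gDil]
  have hmap := Measure.map_linearMap_addHaar_eq_smul_addHaar (volume : Measure (GPt n)) hf0
  have h1 : ∫⁻ z, F (gDil r z) = ENNReal.ofReal ((r ^ (n + 2))⁻¹) * ∫⁻ z, F z := by
    simp_rw [← hfe]
    rw [← lintegral_map hF hmeas, hmap, lintegral_smul_measure, hfdet,
      abs_of_pos (by positivity), smul_eq_mul]
  rw [lintegral_const_mul' _ _ ENNReal.ofReal_ne_top, h1, ← mul_assoc,
    ← ENNReal.ofReal_mul (by positivity), mul_inv_cancel₀ (by positivity), ENNReal.ofReal_one,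
    one_mul]

theorem measurable_gDil_uncurry {n : ℕ} :
    Measurable fun q : ℝ × GPt n => gDil q.1 q.2 := by
  have : Continuous fun q : ℝ × GPt n => gDil q.1 q.2 := by unfold gDil; fun_prop
  exact this.measurable

theorem lintegral_gShell_indicator {n : ℕ} {z : GPt n} (hz : z ≠ 0) :
    ∫⁻ s : ℝ, (gShell n).indicator (fun _ => (1 : ENNReal)) (gDil (exp s) z) = 1 := by
  have hρ := gNorm_pos hz
  have h : (fun s : ℝ => (gShell n).indicator (fun _ => (1 : ENNReal)) (gDil (exp s) z)) =
      (Set.Ico (-log (gNorm z)) (1 - log (gNorm z))).indicator fun _ => 1 := by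
    ext s
    have h1 : gDil (exp s) z ∈ gShell n ↔ s ∈ Set.Ico (-log (gNorm z)) (1 - log (gNorm z)) := by
      have he : exp s * gNorm z = exp (s + log (gNorm z)) := by rw [exp_add, exp_log hρ]
      simp only [gShell, Set.mem_ofPred_eq, gNorm_gDil (exp_pos s).le, he, Set.mem_Ico,
        Real.one_le_exp_iff, Real.exp_lt_exp]
      constructor <;> rintro ⟨h1, h2⟩ <;> constructor <;> linarith
    by_cases hs : s ∈ Set.Ico (-log (gNorm z)) (1 - log (gNorm z))
    · rw [Set.indicator_of_mem hs, Set.indicator_of_mem (h1.2 hs)]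
    · rw [Set.indicator_of_notMem hs, Set.indicator_of_notMem (mt h1.1 hs)]
  rw [h, lintegral_indicator measurableSet_Ico, setLIntegral_const, Real.volume_Ico]
  simp

/-- Integration along the dilation orbits, in the logarithmic variable `σ = log (R/ϱ)`. -/
theorem lintegral_eq_lintegral_gShell {n : ℕ} {R : ℝ} (hR : 0 < R) {F : GPt n → ENNReal}
    (hF : Measurable F) :
    ∫⁻ z, F z = ∫⁻ w in gShell n, ∫⁻ σ : ℝ,
      ENNReal.ofReal ((R * exp (-σ) / gNorm w) ^ (n + 2)) *
        F (gDil (R * exp (-σ) / gNorm w) w) := by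
  set S : GPt n → ENNReal := (gShell n).indicator fun _ => 1 with hS
  have hSm : Measurable S := measurable_const.indicator (measurableSet_gShell n)
  have hdm : Measurable fun q : GPt n × ℝ => gDil (exp q.2) q.1 :=
    measurable_gDil_uncurry.comp ((measurable_exp.comp measurable_snd).prodMk measurable_fst)
  have hdm' : Measurable fun q : ℝ × GPt n => gDil (exp (-q.1)) q.2 :=
    measurable_gDil_uncurry.comp
      ((measurable_exp.comp measurable_fst.neg).prodMk measurable_snd)
  have hdz : ∀ s : ℝ, Measurable fun z : GPt n => gDil (exp s) z := fun s =>
    hdm.comp (measurable_id.prodMk measurable_const)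
  calc ∫⁻ z, F z = ∫⁻ z, ∫⁻ s : ℝ, F z * S (gDil (exp s) z) := by
        refine lintegral_congr_ae ?_
        filter_upwards [compl_mem_ae_iff.2 (measure_singleton (0 : GPt n))] with z hz
        have hm : Measurable fun s : ℝ => S (gDil (exp s) z) :=
          hSm.comp (hdm.comp (measurable_const.prodMk measurable_id))
        rw [lintegral_const_mul _ hm,
          lintegral_gShell_indicator hz, mul_one]
    _ = ∫⁻ s : ℝ, ∫⁻ z, F z * S (gDil (exp s) z) :=
        lintegral_lintegral_swap
          ((hF.comp measurable_fst).mul (hSm.comp hdm)).aemeasurable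
    _ = ∫⁻ s : ℝ, ∫⁻ w, ENNReal.ofReal (exp (-s) ^ (n + 2)) * F (gDil (exp (-s)) w) * S w := by
        refine lintegral_congr fun s => ?_
        have hm : Measurable fun z => F z * S (gDil (exp s) z) := hF.mul (hSm.comp (hdz s))
        rw [lintegral_gDil (exp_pos (-s)) hm]
        refine lintegral_congr fun w => ?_
        rw [gDil_gDil, ← exp_add, add_neg_cancel, exp_zero, gDil_one, mul_assoc]
    _ = ∫⁻ w, ∫⁻ s : ℝ, ENNReal.ofReal (exp (-s) ^ (n + 2)) * F (gDil (exp (-s)) w) * S w :=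
        lintegral_lintegral_swap
          ((Measurable.mul (by fun_prop) (hF.comp hdm')).mul
            (hSm.comp measurable_snd)).aemeasurable
    _ = ∫⁻ w in gShell n, ∫⁻ s : ℝ,
          ENNReal.ofReal (exp (-s) ^ (n + 2)) * F (gDil (exp (-s)) w) := by
        rw [← lintegral_indicator (measurableSet_gShell n)]
        refine lintegral_congr fun w => ?_
        by_cases hw : w ∈ gShell n
        · simp [hS, Set.indicator_of_mem hw]
        · simp [hS, Set.indicator_of_notMem hw]
    _ = _ := by
        refine setLIntegral_congr_fun (measurableSet_gShell n) fun w hw => ?_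
        have hρ := gNorm_pos_of_mem_gShell hw
        rw [← lintegral_add_right_eq_self _ (-log (R / gNorm w))]
        refine lintegral_congr fun σ => ?_
        have : exp (-(σ + -log (R / gNorm w))) = R * exp (-σ) / gNorm w := by
          rw [neg_add, neg_neg, exp_add, exp_log (by positivity)]; ring
        rw [this]

theorem volume_gShell_lt_top (n : ℕ) : volume (gShell n) < ⊤ :=
  ((isBounded_gNorm_le (exp 1)).subset fun _ hw => hw.2.le).measure_lt_top

/-- A function along a dilation orbit, in the logarithmic variable `σ = log (R/ϱ)`. -/
def gOrbit {n : ℕ} (R : ℝ) (u : GPt n → ℝ) (w : GPt n) (σ : ℝ) : ℝ :=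
  u (gDil (R * exp (-σ) / gNorm w) w)

theorem gNorm_gDil_orbit {n : ℕ} {R : ℝ} (hR : 0 < R) {w : GPt n} (hw : 0 < gNorm w) (σ : ℝ) :
    gNorm (gDil (R * exp (-σ) / gNorm w) w) = R * exp (-σ) := by
  rw [gNorm_gDil (by positivity)]
  field_simp

theorem contDiff_gOrbit {n : ℕ} {R : ℝ} {u : GPt n → ℝ} (hu : ContDiff ℝ (⊤ : ℕ∞) u)
    (w : GPt n) : ContDiff ℝ (⊤ : ℕ∞) (gOrbit R u w) := by
  unfold gOrbit gDil
  refine hu.comp (ContDiff.prodMk ?_ ?_)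
  · fun_prop
  · fun_prop

theorem radialDeriv_eq_fderiv {n : ℕ} {u : GPt n → ℝ} (hu : Differentiable ℝ u) (z : GPt n) :
    radialDeriv u z = fderiv ℝ u z ((gNorm z)⁻¹ • z.1, 2 / gNorm z * z.2) := by
  rcases eq_or_ne z 0 with rfl | hz
  · simp [radialDeriv, gNorm_zero, ← Prod.zero_eq_mk]
  have hρ := gNorm_pos hz
  have h1 : HasDerivAt (fun s : ℝ => (s / gNorm z) • z.1) ((gNorm z)⁻¹ • z.1) (gNorm z) := by
    simpa using ((hasDerivAt_id (gNorm z)).div_const (gNorm z)).smul_const z.1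
  have h2 : HasDerivAt (fun s : ℝ => (s ^ 2 / gNorm z ^ 2) * z.2) (2 / gNorm z * z.2)
      (gNorm z) := by
    refine (((hasDerivAt_pow 2 (gNorm z)).div_const (gNorm z ^ 2)).mul_const z.2).congr_deriv ?_
    field_simp
    norm_num
    ring
  have h3 := h1.prodMk h2
  have hz' : ((gNorm z / gNorm z) • z.1, (gNorm z ^ 2 / gNorm z ^ 2) * z.2) = z := by
    rw [div_self hρ.ne', div_self (by positivity), one_smul, one_mul]
  have h4 := (hu ((gNorm z / gNorm z) • z.1,
    (gNorm z ^ 2 / gNorm z ^ 2) * z.2)).hasFDerivAt.comp_hasDerivAt (gNorm z) h3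
  rw [hz'] at h4
  exact h4.deriv

theorem measurable_radialDeriv {n : ℕ} {u : GPt n → ℝ} (hu : ContDiff ℝ (⊤ : ℕ∞) u) :
    Measurable (radialDeriv u) := by
  have h : radialDeriv u = fun z => fderiv ℝ u z ((gNorm z)⁻¹ • z.1, 2 / gNorm z * z.2) :=
    funext (radialDeriv_eq_fderiv (hu.differentiable (by simp)))
  rw [h]
  have hc : Continuous fun q : GPt n × GPt n => fderiv ℝ u q.1 q.2 :=
    ((hu.continuous_fderiv (by simp)).comp continuous_fst).clm_apply continuous_snd
  have hg := (continuous_gNorm (n := n)).measurable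
  refine hc.measurable.comp (measurable_id.prodMk (Measurable.prodMk ?_ ?_))
  · exact hg.inv.smul measurable_fst
  · exact (measurable_const.div hg).mul measurable_snd

theorem deriv_gOrbit {n : ℕ} {R : ℝ} (hR : 0 < R) {u : GPt n → ℝ} (hu : Differentiable ℝ u)
    {w : GPt n} (hw : 0 < gNorm w) (σ : ℝ) :
    deriv (gOrbit R u w) σ =
      -(R * exp (-σ) * radialDeriv u (gDil (R * exp (-σ) / gNorm w) w)) := by
  set r := R * exp (-σ) with hr
  have hr0 : 0 < r := by positivity
  have hk : (fun s : ℝ => u ((s / gNorm (gDil (r / gNorm w) w)) • (gDil (r / gNorm w) w).1,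
      (s ^ 2 / gNorm (gDil (r / gNorm w) w) ^ 2) * (gDil (r / gNorm w) w).2)) =
      fun s => u (gDil (s / gNorm w) w) := by
    funext s
    rw [hr, gNorm_gDil_orbit hR hw, ← hr]
    congr 1
    ext
    · simp [gDil]; field_simp
    · simp [gDil]; field_simp
  have hd : Differentiable ℝ fun s => u (gDil (s / gNorm w) w) := by
    unfold gDil
    exact hu.comp (Differentiable.prodMk (by fun_prop) (by fun_prop))
  unfold radialDeriv
  rw [hk, hr, gNorm_gDil_orbit hR hw]
  have h1 : HasDerivAt (fun σ : ℝ => R * exp (-σ)) (R * (exp (-σ) * -1)) σ :=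
    ((hasDerivAt_neg σ).exp).const_mul R
  have h2 := (hd (R * exp (-σ))).hasDerivAt.comp σ h1
  have h3 : deriv (gOrbit R u w) σ = _ := h2.deriv
  rw [h3]; ring

/-- Polar integration over the gauge ball. -/
theorem setLIntegral_ball_eq {n : ℕ} {R : ℝ} (hR : 0 < R) {F : GPt n → ENNReal}
    (hF : Measurable F) :
    ∫⁻ z in {z : GPt n | gNorm z < R}, F z = ∫⁻ w in gShell n, ∫⁻ σ in Set.Ioi (0 : ℝ),
      ENNReal.ofReal ((R * exp (-σ) / gNorm w) ^ (n + 2)) *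
        F (gDil (R * exp (-σ) / gNorm w) w) := by
  have hB : MeasurableSet {z : GPt n | gNorm z < R} :=
    measurableSet_lt continuous_gNorm.measurable measurable_const
  rw [← lintegral_indicator hB, lintegral_eq_lintegral_gShell hR (hF.indicator hB)]
  refine setLIntegral_congr_fun (measurableSet_gShell n) fun w hw => ?_
  have hρ := gNorm_pos_of_mem_gShell hw
  rw [← lintegral_indicator measurableSet_Ioi]
  refine lintegral_congr fun σ => ?_
  have hiff : gDil (R * exp (-σ) / gNorm w) w ∈ {z : GPt n | gNorm z < R} ↔
      σ ∈ Set.Ioi (0 : ℝ) := by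
    rw [Set.mem_ofPred_eq, gNorm_gDil_orbit hR hρ, mul_lt_iff_lt_one_right hR, Real.exp_lt_one_iff,
      neg_lt_zero, Set.mem_Ioi]
  by_cases hσ : σ ∈ Set.Ioi (0 : ℝ)
  · rw [Set.indicator_of_mem hσ, Set.indicator_of_mem (hiff.2 hσ)]
  · rw [Set.indicator_of_notMem hσ, Set.indicator_of_notMem (mt hiff.1 hσ), mul_zero]

/-- The angular weight of the polar decomposition. -/
def gAngular {n : ℕ} (R p α : ℝ) (w : GPt n) : ENNReal :=
  ENNReal.ofReal (gPsi w ^ (p / 2) / gNorm w ^ (n + 2) * R ^ α)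

theorem orbit_weight_mul {n : ℕ} {Q R p a c d α : ℝ} (hQ : Q = n + 2) (hR : 0 < R)
    (hα : α = Q - a) {w : GPt n} (hw : 0 < gNorm w) {σ : ℝ} (hσ : 0 < σ) :
    (R * exp (-σ) / gNorm w) ^ (n + 2) *
        (c * gPsi w ^ (p / 2) / ((R * exp (-σ)) ^ a * log (R / (R * exp (-σ))) ^ d)) =
      gPsi w ^ (p / 2) / gNorm w ^ (n + 2) * R ^ α * (c * exp (-α * σ) * σ ^ (-d)) := by
  have hl : log (R / (R * exp (-σ))) = σ := by
    rw [div_mul_cancel_left₀ hR.ne', exp_neg, inv_inv, log_exp]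
  have hr : 0 < R * exp (-σ) := by positivity
  have h1 : (R * exp (-σ)) ^ (n + 2) / (R * exp (-σ)) ^ a = R ^ α * exp (-α * σ) := by
    have : exp (-α * σ) = exp (-σ) ^ α := by rw [← exp_mul]; congr 1; ring
    rw [this, ← Real.mul_rpow hR.le (exp_pos _).le, hα, Real.rpow_sub hr, hQ]
    norm_cast
  rw [hl, Real.rpow_neg hσ.le, div_pow]
  calc _ = (R * exp (-σ)) ^ (n + 2) / (R * exp (-σ)) ^ a * (gPsi w ^ (p / 2) / gNorm w ^ (n + 2))
        * c * (σ ^ d)⁻¹ := by field_simp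
    _ = _ := by rw [h1]; ring

theorem measurable_hardy_right {n : ℕ} {R p a b : ℝ} {u : GPt n → ℝ}
    (hu : ContDiff ℝ (⊤ : ℕ∞) u) :
    Measurable fun z => |u z| ^ p * gPsi z ^ (p / 2) /
      (gNorm z ^ a * log (R / gNorm z) ^ b) := by
  have h1 := hu.continuous.measurable
  have h2 := (continuous_gNorm (n := n)).measurable
  have h3 := measurable_gPsi (n := n)
  have h4 : Measurable fun z => |u z| := h1.abs
  exact ((h4.pow_const p).mul (h3.pow_const _)).div
    ((h2.pow_const a).mul ((measurable_log.comp (measurable_const.div h2)).pow_const b))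

theorem measurable_hardy_left {n : ℕ} {R p a b : ℝ} {u : GPt n → ℝ}
    (hu : ContDiff ℝ (⊤ : ℕ∞) u) :
    Measurable fun z => gPsi z ^ (p / 2) * |radialDeriv u z| ^ p /
      (gNorm z ^ (a - p) * log (R / gNorm z) ^ (b - p)) := by
  have h1 := measurable_radialDeriv hu
  have h2 := (continuous_gNorm (n := n)).measurable
  have h3 := measurable_gPsi (n := n)
  have h4 : Measurable fun z => |radialDeriv u z| := h1.abs
  exact ((h3.pow_const _).mul (h4.pow_const p)).div
    ((h2.pow_const _).mul ((measurable_log.comp (measurable_const.div h2)).pow_const _))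

theorem lintegral_hardy_right {n : ℕ} {Q R p a b α : ℝ} (hQ : Q = n + 2) (hR : 0 < R)
    (hα : α = Q - a) {u : GPt n → ℝ} (hu : ContDiff ℝ (⊤ : ℕ∞) u) :
    ∫⁻ z in {z : GPt n | gNorm z < R}, ENNReal.ofReal (|u z| ^ p * gPsi z ^ (p / 2) /
        (gNorm z ^ a * log (R / gNorm z) ^ b)) =
      ∫⁻ w in gShell n, gAngular R p α w * ∫⁻ σ in Set.Ioi (0 : ℝ),
        ENNReal.ofReal (|gOrbit R u w σ| ^ p * exp (-α * σ) * σ ^ (-b)) := by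
  rw [setLIntegral_ball_eq hR (measurable_hardy_right hu).ennreal_ofReal]
  refine setLIntegral_congr_fun (measurableSet_gShell n) fun w hw => ?_
  have hρ := gNorm_pos_of_mem_gShell hw
  have hψ := gPsi_nonneg w
  unfold gAngular
  rw [← lintegral_const_mul' _ _ ENNReal.ofReal_ne_top]
  refine setLIntegral_congr_fun measurableSet_Ioi fun σ hσ => ?_
  rw [← ENNReal.ofReal_mul (by positivity), ← ENNReal.ofReal_mul (by positivity),
    gNorm_gDil_orbit hR hρ, gPsi_gDil (by positivity), orbit_weight_mul hQ hR hα hρ hσ]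
  rfl

theorem lintegral_hardy_left {n : ℕ} {Q R p a b α : ℝ} (hQ : Q = n + 2) (hR : 0 < R)
    (hα : α = Q - a) {u : GPt n → ℝ} (hu : ContDiff ℝ (⊤ : ℕ∞) u) :
    ∫⁻ z in {z : GPt n | gNorm z < R}, ENNReal.ofReal (gPsi z ^ (p / 2) * |radialDeriv u z| ^ p /
        (gNorm z ^ (a - p) * log (R / gNorm z) ^ (b - p))) =
      ∫⁻ w in gShell n, gAngular R p α w * ∫⁻ σ in Set.Ioi (0 : ℝ),
        ENNReal.ofReal (|deriv (gOrbit R u w) σ| ^ p * exp (-α * σ) * σ ^ (p - b)) := by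
  rw [setLIntegral_ball_eq hR (measurable_hardy_left hu).ennreal_ofReal]
  refine setLIntegral_congr_fun (measurableSet_gShell n) fun w hw => ?_
  have hρ := gNorm_pos_of_mem_gShell hw
  have hψ := gPsi_nonneg w
  unfold gAngular
  rw [← lintegral_const_mul' _ _ ENNReal.ofReal_ne_top]
  refine setLIntegral_congr_fun measurableSet_Ioi fun σ hσ => ?_
  have hr : 0 < R * exp (-σ) := by positivity
  rw [← ENNReal.ofReal_mul (by positivity), ← ENNReal.ofReal_mul (by positivity),
    gNorm_gDil_orbit hR hρ, gPsi_gDil (by positivity), ← neg_sub b p,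
    ← orbit_weight_mul hQ hR hα hρ hσ, deriv_gOrbit hR (hu.differentiable (by simp)) hρ σ,
    abs_neg, abs_mul, abs_of_pos hr, Real.mul_rpow hr.le (abs_nonneg _), Real.rpow_sub hr]
  congr 2
  field_simp

theorem gAngular_le {n : ℕ} {R p α : ℝ} (hp : 0 ≤ p) (hR : 0 < R) {w : GPt n}
    (hw : w ∈ gShell n) : gAngular R p α w ≤ ENNReal.ofReal (R ^ α) := by
  refine ENNReal.ofReal_le_ofReal ?_
  have h1 : gPsi w ^ (p / 2) ≤ 1 :=
    Real.rpow_le_one (gPsi_nonneg w) (gPsi_le_one w) (by positivity)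
  have h2 : 1 ≤ gNorm w ^ (n + 2) := one_le_pow₀ hw.1
  have h3 : gPsi w ^ (p / 2) / gNorm w ^ (n + 2) ≤ 1 :=
    div_le_one_of_le₀ (h1.trans h2) (by positivity)
  exact mul_le_of_le_one_left (by positivity) h3

theorem measurable_gAngular {n : ℕ} {R p α : ℝ} :
    Measurable (gAngular R p α : GPt n → ENNReal) :=
  (((measurable_gPsi.pow_const _).div
    (continuous_gNorm.measurable.pow_const _)).mul_const _).ennreal_ofReal

/-- The support of a test function in the gauge ball stays away from the boundary. -/
theorem IsTest.exists_gNorm_le {n : ℕ} {R : ℝ} (hR : 0 < R) {u : GPt n → ℝ}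
    (hu : IsTest {z : GPt n | gNorm z < R} u) :
    ∃ σ₀ : ℝ, 0 < σ₀ ∧ ∀ z, u z ≠ 0 → gNorm z ≤ R * exp (-σ₀) := by
  obtain ⟨-, hc, hs⟩ := hu
  obtain ⟨m, hm0, hmR, hm⟩ : ∃ m : ℝ, 0 < m ∧ m < R ∧ ∀ z, u z ≠ 0 → gNorm z ≤ m := by
    rcases (tsupport u).eq_empty_or_nonempty with he | hne
    · refine ⟨R / 2, by positivity, by linarith, fun z hz => ?_⟩
      have := subset_tsupport u hz
      rw [he] at this
      exact this.elim
    · obtain ⟨z₀, hz₀, hmax⟩ := hc.isCompact.exists_isMaxOn hne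
        (continuous_gNorm (n := n)).continuousOn
      refine ⟨max (gNorm z₀) (R / 2), by positivity, max_lt (hs hz₀) (by linarith), fun z hz => ?_⟩
      exact le_max_of_le_left (hmax (subset_tsupport u hz))
  refine ⟨log (R / m), log_pos ((one_lt_div hm0).2 hmR), fun z hz => (hm z hz).trans_eq ?_⟩
  rw [exp_neg, exp_log (by positivity)]
  field_simp

theorem IsTest.exists_abs_radialDeriv_le {n : ℕ} {R : ℝ} {u : GPt n → ℝ}
    (hu : IsTest {z : GPt n | gNorm z < R} u) :
    ∃ M : ℝ, 0 ≤ M ∧ ∀ z, |radialDeriv u z| ≤ M := by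
  obtain ⟨hd, hc, hs⟩ := hu
  obtain ⟨C, hC⟩ := (hc.fderiv (𝕜 := ℝ)).exists_bound_of_continuous
    (hd.continuous_fderiv (by simp))
  have hC0 : 0 ≤ C := (norm_nonneg _).trans (hC 0)
  refine ⟨C * max 1 R, by positivity, fun z => ?_⟩
  rw [radialDeriv_eq_fderiv (hd.differentiable (by simp))]
  by_cases hz : z ∈ tsupport u
  · have hzR : gNorm z < R := hs hz
    refine ((fderiv ℝ u z).le_opNorm _).trans ?_
    refine mul_le_mul (hC z) ?_ (norm_nonneg _) hC0
    rcases eq_or_ne z 0 with rfl | hz0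
    · simp
    have hρ := gNorm_pos hz0
    rw [Prod.norm_def]
    refine max_le_max ?_ ?_
    · simp only
      rw [norm_smul, norm_inv, Real.norm_eq_abs, abs_of_pos hρ, inv_mul_le_one₀ hρ]
      exact norm_fst_le_gNorm z
    · simp only
      rw [Real.norm_eq_abs, abs_mul, abs_div, abs_two, abs_of_pos hρ, div_mul_eq_mul_div,
        div_le_iff₀ hρ]
      nlinarith [two_mul_abs_snd_le_gNorm_sq z]
  · have : fderiv ℝ u z = 0 := by
      by_contra h
      exact hz (support_fderiv_subset ℝ h)
    simp [this]
    positivity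

theorem lintegral_hardy_le {n : ℕ} {Q R p a b : ℝ} (hQ : Q = n + 2) (hR : 0 < R) (hp : 1 < p)
    (hpb : p ≤ b) (ha : a ≤ Q) {u : GPt n → ℝ} (hu : IsTest {z : GPt n | gNorm z < R} u) :
    ENNReal.ofReal (((b - 1) / p) ^ p) *
      ∫⁻ z in {z : GPt n | gNorm z < R}, ENNReal.ofReal (|u z| ^ p * gPsi z ^ (p / 2) /
        (gNorm z ^ a * log (R / gNorm z) ^ b)) ≤
      ∫⁻ z in {z : GPt n | gNorm z < R},
        ENNReal.ofReal (gPsi z ^ (p / 2) * |radialDeriv u z| ^ p /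
          (gNorm z ^ (a - p) * log (R / gNorm z) ^ (b - p))) := by
  obtain ⟨σ₀, hσ₀, hsupp⟩ := hu.exists_gNorm_le hR
  rw [lintegral_hardy_right hQ hR rfl hu.1, lintegral_hardy_left hQ hR rfl hu.1,
    ← lintegral_const_mul' _ _ ENNReal.ofReal_ne_top]
  refine setLIntegral_mono' (measurableSet_gShell n) fun w hw => ?_
  have hρ := gNorm_pos_of_mem_gShell hw
  have hd := contDiff_gOrbit (R := R) hu.1 w
  rw [mul_left_comm]
  gcongr
  refine hardy_lintegral_Ioi hp hpb (sub_nonneg.2 ha) (half_pos hσ₀)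
    (hd.differentiable (by simp)) (hd.continuous_deriv (by simp)) fun s hs => ?_
  by_contra h
  have h1 := hsupp _ h
  rw [gNorm_gDil_orbit hR hρ, mul_le_mul_iff_of_pos_left hR, exp_le_exp] at h1
  linarith

theorem lintegral_hardy_left_lt_top {n : ℕ} {Q R p a b : ℝ} (hQ : Q = n + 2) (hR : 0 < R)
    (hp : 1 < p) (hpb : p ≤ b) (ha : a ≤ Q) {u : GPt n → ℝ}
    (hu : IsTest {z : GPt n | gNorm z < R} u) :
    ∫⁻ z in {z : GPt n | gNorm z < R},
      ENNReal.ofReal (gPsi z ^ (p / 2) * |radialDeriv u z| ^ p /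
        (gNorm z ^ (a - p) * log (R / gNorm z) ^ (b - p))) < ⊤ := by
  obtain ⟨σ₀, hσ₀, hsupp⟩ := hu.exists_gNorm_le hR
  obtain ⟨M, hM0, hM⟩ := hu.exists_abs_radialDeriv_le
  have hp0 : 0 < p := by linarith
  rw [lintegral_hardy_left hQ hR rfl hu.1]
  set C := ∫⁻ σ in Set.Ioi (0 : ℝ), ENNReal.ofReal ((R * M) ^ p * σ₀ ^ (p - b) * exp (-p * σ))
    with hC
  have hCtop : C < ⊤ :=
    ((exp_neg_integrableOn_Ioi 0 hp0).const_mul ((R * M) ^ p * σ₀ ^ (p - b))).lintegral_lt_top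
  calc _ ≤ ∫⁻ w in gShell n, ENNReal.ofReal (R ^ (Q - a)) * C := by
        refine setLIntegral_mono' (measurableSet_gShell n) fun w hw => ?_
        refine mul_le_mul' (gAngular_le hp0.le hR hw) ?_
        have hρ := gNorm_pos_of_mem_gShell hw
        refine setLIntegral_mono' measurableSet_Ioi fun σ (hσ : 0 < σ) => ?_
        refine ENNReal.ofReal_le_ofReal ?_
        by_cases h : σ < σ₀
        · have hz : deriv (gOrbit R u w) σ = 0 := by
            have : gOrbit R u w =ᶠ[nhds σ] fun _ => 0 := by
              filter_upwards [Iio_mem_nhds h] with s hs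
              by_contra hne
              have h1 := hsupp _ hne
              rw [gNorm_gDil_orbit hR hρ, mul_le_mul_iff_of_pos_left hR, exp_le_exp] at h1
              have hs' : s < σ₀ := hs
              linarith
            rw [this.deriv_eq, deriv_const]
          rw [hz, abs_zero, Real.zero_rpow hp0.ne']
          simp only [zero_mul]
          positivity
        · rw [not_lt] at h
          have h1 : |deriv (gOrbit R u w) σ| ^ p ≤ (R * M) ^ p * exp (-p * σ) := by
            have he : exp (-p * σ) = exp (-σ) ^ p := by rw [← exp_mul]; congr 1; ring
            rw [he, ← Real.mul_rpow (by positivity) (by positivity)]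
            refine Real.rpow_le_rpow (abs_nonneg _) ?_ hp0.le
            rw [deriv_gOrbit hR (hu.1.differentiable (by simp)) hρ, abs_neg, abs_mul,
              abs_of_pos (by positivity : 0 < R * exp (-σ))]
            calc _ ≤ R * exp (-σ) * M := by gcongr; exact hM _
              _ = _ := by ring
          have h2 : exp (-(Q - a) * σ) ≤ 1 := by
            rw [Real.exp_le_one_iff]
            nlinarith [sub_nonneg.2 ha]
          have h3 : σ ^ (p - b) ≤ σ₀ ^ (p - b) :=
            Real.rpow_le_rpow_of_nonpos hσ₀ h (by linarith)
          calc _ ≤ (R * M) ^ p * exp (-p * σ) * 1 * σ₀ ^ (p - b) := by gcongr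
            _ = _ := by ring
    _ = ENNReal.ofReal (R ^ (Q - a)) * C * volume (gShell n) := setLIntegral_const _ _
    _ < ⊤ := ENNReal.mul_lt_top (ENNReal.mul_lt_top ENNReal.ofReal_lt_top hCtop)
        (volume_gShell_lt_top n)

theorem log_div_gNorm_nonneg {n : ℕ} {R : ℝ} {z : GPt n} (hz : gNorm z < R) :
    0 ≤ log (R / gNorm z) := by
  rcases (gNorm_nonneg z).eq_or_lt with h | h
  · simp [← h]
  · exact log_nonneg ((one_le_div h).2 hz.le)

theorem measurableSet_gBall (n : ℕ) (R : ℝ) : MeasurableSet {z : GPt n | gNorm z < R} :=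
  measurableSet_lt continuous_gNorm.measurable measurable_const

theorem integral_hardy_right {n : ℕ} {R p a b : ℝ} {u : GPt n → ℝ}
    (hu : ContDiff ℝ (⊤ : ℕ∞) u) :
    ∫ z in {z : GPt n | gNorm z < R}, |u z| ^ p * gPsi z ^ (p / 2) /
        (gNorm z ^ a * log (R / gNorm z) ^ b) =
      (∫⁻ z in {z : GPt n | gNorm z < R}, ENNReal.ofReal (|u z| ^ p * gPsi z ^ (p / 2) /
        (gNorm z ^ a * log (R / gNorm z) ^ b))).toReal := by
  refine integral_eq_lintegral_of_nonneg_ae ?_ (measurable_hardy_right hu).aestronglyMeasurable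
  refine (ae_restrict_mem (measurableSet_gBall n R)).mono fun z hz => ?_
  have h1 := log_div_gNorm_nonneg hz
  have h2 := gPsi_nonneg z
  have h3 := gNorm_nonneg z
  simp only [Pi.zero_apply]
  positivity

theorem integral_hardy_left {n : ℕ} {R p a b : ℝ} {u : GPt n → ℝ}
    (hu : ContDiff ℝ (⊤ : ℕ∞) u) :
    ∫ z in {z : GPt n | gNorm z < R}, gPsi z ^ (p / 2) * |radialDeriv u z| ^ p /
        (gNorm z ^ (a - p) * log (R / gNorm z) ^ (b - p)) =
      (∫⁻ z in {z : GPt n | gNorm z < R},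
        ENNReal.ofReal (gPsi z ^ (p / 2) * |radialDeriv u z| ^ p /
          (gNorm z ^ (a - p) * log (R / gNorm z) ^ (b - p)))).toReal := by
  refine integral_eq_lintegral_of_nonneg_ae ?_ (measurable_hardy_left hu).aestronglyMeasurable
  refine (ae_restrict_mem (measurableSet_gBall n R)).mono fun z hz => ?_
  have h1 := log_div_gNorm_nonneg hz
  have h2 := gPsi_nonneg z
  have h3 := gNorm_nonneg z
  simp only [Pi.zero_apply]
  positivity

theorem integral_hardy_le {n : ℕ} {Q R p a b : ℝ} (hQ : Q = n + 2) (hR : 0 < R) (hp : 1 < p)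
    (hpb : p ≤ b) (ha : a ≤ Q) {u : GPt n → ℝ} (hu : IsTest {z : GPt n | gNorm z < R} u) :
    ((b - 1) / p) ^ p * ∫ z in {z : GPt n | gNorm z < R}, |u z| ^ p * gPsi z ^ (p / 2) /
        (gNorm z ^ a * log (R / gNorm z) ^ b) ≤
      ∫ z in {z : GPt n | gNorm z < R}, gPsi z ^ (p / 2) * |radialDeriv u z| ^ p /
        (gNorm z ^ (a - p) * log (R / gNorm z) ^ (b - p)) := by
  have hc : 0 ≤ ((b - 1) / p) ^ p :=
    Real.rpow_nonneg (div_nonneg (by linarith) (by linarith)) _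
  rw [integral_hardy_right hu.1, integral_hardy_left hu.1]
  have h := ENNReal.toReal_mono (lintegral_hardy_left_lt_top hQ hR hp hpb ha hu).ne
    (lintegral_hardy_le hQ hR hp hpb ha hu)
  rwa [ENNReal.toReal_mul, ENNReal.toReal_ofReal hc] at h

/-- The radial function with profile `h` in the variable `log (R/ϱ)`. -/
def gRadial (n : ℕ) (R : ℝ) (h : ℝ → ℝ) (z : GPt n) : ℝ := h (log (R / gNorm z))

theorem contDiffAt_gNorm {n : ℕ} {z : GPt n} (hz : z ≠ 0) :
    ContDiffAt ℝ (⊤ : ℕ∞) (gNorm : GPt n → ℝ) z := by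
  have h : ContDiff ℝ (⊤ : ℕ∞) fun z : GPt n => ‖z.1‖ ^ 4 + 4 * z.2 ^ 2 := by
    have e : (fun z : GPt n => ‖z.1‖ ^ 4 + 4 * z.2 ^ 2) =
        fun z => (‖z.1‖ ^ 2) ^ 2 + 4 * z.2 ^ 2 := by
      funext z; ring
    rw [e]
    exact (((contDiff_fst.norm_sq ℝ).pow 2)).add (contDiff_const.mul (contDiff_snd.pow 2))
  exact h.contDiffAt.rpow_const_of_ne (gNorm_base_pos hz).ne'

theorem isTest_gRadial {n : ℕ} {R s₀ s₁ : ℝ} (hR : 0 < R) (hs₀ : 0 < s₀) {h : ℝ → ℝ}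
    (hh : ContDiff ℝ (⊤ : ℕ∞) h) (h0 : ∀ s < s₀, h s = 0) (h1 : ∀ s, s₁ < s → h s = 0) :
    IsTest {z : GPt n | gNorm z < R} (gRadial n R h) := by
  have hz0 : gRadial n R h 0 = 0 := by
    simp [gRadial, gNorm_zero, h0 0 hs₀]
  have hsub : tsupport (gRadial n R h) ⊆ {z : GPt n | gNorm z ≤ R * exp (-s₀)} := by
    refine closure_minimal (fun z hz => ?_) (isClosed_le continuous_gNorm continuous_const)
    rcases eq_or_ne z 0 with rfl | hne
    · exact absurd hz0 hz
    have hρ := gNorm_pos hne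
    by_contra hlt
    rw [Set.mem_ofPred_eq, not_le] at hlt
    refine hz (h0 _ ?_)
    rw [Real.log_lt_iff_lt_exp (by positivity), div_lt_iff₀ hρ]
    calc R = exp s₀ * (R * exp (-s₀)) := by
          rw [mul_left_comm, ← exp_add, add_neg_cancel, exp_zero, mul_one]
      _ < _ := by gcongr
  refine ⟨contDiff_iff_contDiffAt.2 fun z => ?_, ?_, hsub.trans fun z hz => ?_⟩
  · rcases eq_or_ne z 0 with rfl | hne
    · have hev : gRadial n R h =ᶠ[nhds 0] fun _ => 0 := by
        have hopen : IsOpen {z : GPt n | gNorm z < R * exp (-s₁)} :=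
          isOpen_lt continuous_gNorm continuous_const
        have hmem : (0 : GPt n) ∈ {z : GPt n | gNorm z < R * exp (-s₁)} := by
          rw [Set.mem_ofPred_eq, gNorm_zero]; positivity
        filter_upwards [hopen.mem_nhds hmem] with z hz
        rcases eq_or_ne z 0 with rfl | hne
        · exact hz0
        have hρ := gNorm_pos hne
        refine h1 _ ?_
        rw [Real.lt_log_iff_exp_lt (by positivity), lt_div_iff₀ hρ]
        calc exp s₁ * gNorm z < exp s₁ * (R * exp (-s₁)) := by gcongr
          _ = R := by rw [mul_left_comm, ← exp_add, add_neg_cancel, exp_zero, mul_one]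
      exact contDiffAt_const.congr_of_eventuallyEq hev
    · have hρ := gNorm_pos hne
      exact hh.contDiffAt.comp z
        ((contDiffAt_const.div (contDiffAt_gNorm hne) hρ.ne').log (div_pos hR hρ).ne')
  · exact (Metric.isCompact_of_isClosed_isBounded (isClosed_le continuous_gNorm continuous_const)
      (isBounded_gNorm_le _)).of_isClosed_subset (isClosed_tsupport _) hsub
  · have hz' : gNorm z ≤ R * exp (-s₀) := hz
    refine lt_of_le_of_lt hz' ?_
    rw [mul_lt_iff_lt_one_right hR, Real.exp_lt_one_iff]
    linarith

theorem gOrbit_gRadial {n : ℕ} {R : ℝ} (hR : 0 < R) (h : ℝ → ℝ) {w : GPt n} (hw : 0 < gNorm w) :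
    gOrbit R (gRadial n R h) w = h := by
  funext σ
  unfold gOrbit gRadial
  rw [gNorm_gDil_orbit hR hw, div_mul_cancel_left₀ hR.ne', exp_neg, inv_inv, log_exp]

theorem lintegral_gAngular_lt_top {n : ℕ} {R p α : ℝ} (hp : 0 ≤ p) (hR : 0 < R) :
    ∫⁻ w in gShell n, gAngular R p α w < ⊤ := by
  calc _ ≤ ∫⁻ w in gShell n, ENNReal.ofReal (R ^ α) :=
        setLIntegral_mono' (measurableSet_gShell n) fun w hw => gAngular_le hp hR hw
    _ = ENNReal.ofReal (R ^ α) * volume (gShell n) := setLIntegral_const _ _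
    _ < ⊤ := ENNReal.mul_lt_top ENNReal.ofReal_lt_top (volume_gShell_lt_top n)

theorem lintegral_gAngular_pos {n : ℕ} {R p α : ℝ} (hn : n ≠ 0) (hR : 0 < R) :
    0 < ∫⁻ w in gShell n, gAngular R p α w := by
  rw [setLIntegral_pos_iff measurable_gAngular]
  have hopen : IsOpen {w : GPt n | (1 < gNorm w ∧ gNorm w < exp 1) ∧ w.1 ≠ 0} :=
    ((isOpen_lt continuous_const continuous_gNorm).inter
      (isOpen_lt continuous_gNorm continuous_const)).inter
      (isOpen_ne_fun continuous_fst continuous_const)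
  have hne : {w : GPt n | (1 < gNorm w ∧ gNorm w < exp 1) ∧ w.1 ≠ 0}.Nonempty := by
    have i : Fin n := ⟨0, Nat.pos_of_ne_zero hn⟩
    have hg : gNorm ((EuclideanSpace.single i (2 : ℝ), 0) : GPt n) = 2 := by
      have h4 := gNorm_pow_four ((EuclideanSpace.single i (2 : ℝ), 0) : GPt n)
      refine (pow_left_inj₀ (gNorm_nonneg _) (by norm_num) (n := 4) (by norm_num)).1 ?_
      rw [h4]
      simp
    refine ⟨(EuclideanSpace.single i (2 : ℝ), 0), ⟨?_, ?_⟩, ?_⟩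
    · rw [hg]; norm_num
    · rw [hg]; linarith [Real.exp_one_gt_d9]
    · simp
  refine (hopen.measure_pos volume hne).trans_le (measure_mono ?_)
  rintro w ⟨⟨h1, h2⟩, h3⟩
  refine ⟨?_, h1.le, h2⟩
  have hρ : 0 < gNorm w := zero_lt_one.trans h1
  have hψ : 0 < gPsi w := by
    have : 0 < ‖w.1‖ := norm_pos_iff.2 h3
    unfold gPsi
    positivity
  have : 0 < gPsi w ^ (p / 2) / gNorm w ^ (n + 2) * R ^ α := by positivity
  exact (ENNReal.ofReal_pos.2 this).ne'

/-- The almost-extremal profile `σ^c φ(-ε log σ)` for the Hardy inequality on the half-line. -/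
def hardyProfile (c ε : ℝ) (φ : ℝ → ℝ) (σ : ℝ) : ℝ :=
  if 0 < σ then σ ^ c * φ (-ε * log σ) else 0

theorem hardyProfile_eq_zero {c ε A B : ℝ} {φ : ℝ → ℝ} (hε : 0 < ε)
    (hA : ∀ y ≤ A, φ y = 0) (hB : ∀ y, B ≤ y → φ y = 0) {σ : ℝ}
    (hσ : σ < exp (-B / ε) ∨ exp (-A / ε) < σ) : hardyProfile c ε φ σ = 0 := by
  unfold hardyProfile
  split_ifs with h
  · rcases hσ with hσ | hσ
    · rw [← Real.log_lt_iff_lt_exp h, lt_div_iff₀ hε] at hσ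
      rw [hB _ (by linarith), mul_zero]
    · rw [← Real.lt_log_iff_exp_lt h, div_lt_iff₀ hε] at hσ
      rw [hA _ (by linarith), mul_zero]
  · rfl

theorem contDiff_hardyProfile {c ε A B : ℝ} {φ : ℝ → ℝ} (hε : 0 < ε)
    (hφ : ContDiff ℝ (⊤ : ℕ∞) φ) (hA : ∀ y ≤ A, φ y = 0) (hB : ∀ y, B ≤ y → φ y = 0) :
    ContDiff ℝ (⊤ : ℕ∞) (hardyProfile c ε φ) := by
  refine contDiff_iff_contDiffAt.2 fun σ => ?_
  by_cases h : 0 < σ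
  · have hev : hardyProfile c ε φ =ᶠ[nhds σ] fun s => s ^ c * φ (-ε * log s) := by
      filter_upwards [Ioi_mem_nhds h] with s hs
      exact if_pos hs
    refine ContDiffAt.congr_of_eventuallyEq ?_ hev
    exact (contDiffAt_id.rpow_const_of_ne h.ne').mul
      (hφ.contDiffAt.comp σ (contDiffAt_const.mul (contDiffAt_id.log h.ne')))
  · have hev : hardyProfile c ε φ =ᶠ[nhds σ] fun _ => 0 := by
      have h' : σ < exp (-B / ε) := (not_lt.1 h).trans_lt (exp_pos _)
      filter_upwards [Iio_mem_nhds h'] with s hs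
      exact hardyProfile_eq_zero hε hA hB (Or.inl hs)
    exact contDiffAt_const.congr_of_eventuallyEq hev

theorem hardyProfile_exp {c ε : ℝ} (hε : 0 < ε) (φ : ℝ → ℝ) (y : ℝ) :
    hardyProfile c ε φ (exp (-y / ε)) = exp (-y / ε) ^ c * φ y := by
  unfold hardyProfile
  rw [if_pos (exp_pos _), log_exp]
  congr 2
  field_simp

theorem deriv_hardyProfile_exp {c ε : ℝ} (hε : 0 < ε) {φ : ℝ → ℝ} (hφ : Differentiable ℝ φ)
    (y : ℝ) : deriv (hardyProfile c ε φ) (exp (-y / ε)) =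
      exp (-y / ε) ^ (c - 1) * (c * φ y - ε * deriv φ y) := by
  set σ := exp (-y / ε) with hσ
  have h : 0 < σ := exp_pos _
  have hy : -ε * log σ = y := by rw [hσ, log_exp]; field_simp
  have hev : hardyProfile c ε φ =ᶠ[nhds σ] fun s => s ^ c * φ (-ε * log s) := by
    filter_upwards [Ioi_mem_nhds h] with s hs
    exact if_pos hs
  have h1 := Real.hasDerivAt_rpow_const (x := σ) (p := c) (Or.inl h.ne')
  have h2 : HasDerivAt (fun s => φ (-ε * log s)) (deriv φ y * (-ε * σ⁻¹)) σ := by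
    have h3 := (hφ (-ε * log σ)).hasDerivAt.comp σ ((Real.hasDerivAt_log h.ne').const_mul (-ε))
    rwa [hy] at h3
  have h4 := (h1.mul h2).deriv
  rw [hev.deriv_eq]
  refine h4.trans ?_
  rw [hy, Real.rpow_sub_one h.ne']
  field_simp
  ring

/-- The change of variables `σ = exp (-y/ε)` on the half-line. -/
theorem lintegral_Ioi_eq_lintegral_exp {ε : ℝ} (hε : 0 < ε) (G : ℝ → ENNReal) :
    ∫⁻ σ in Set.Ioi (0 : ℝ), G σ =
      ∫⁻ y, ENNReal.ofReal (exp (-y / ε) * ε⁻¹) * G (exp (-y / ε)) := by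
  have himg : (fun y => exp (-y / ε)) '' Set.univ = Set.Ioi (0 : ℝ) := by
    ext s
    simp only [Set.mem_image, Set.mem_univ, true_and, Set.mem_Ioi]
    constructor
    · rintro ⟨y, rfl⟩; exact exp_pos _
    · intro hs
      refine ⟨-ε * log s, ?_⟩
      have : -(-ε * log s) / ε = log s := by field_simp
      rw [this, exp_log hs]
  have hd : ∀ y ∈ Set.univ, HasDerivWithinAt (fun y => exp (-y / ε))
      (-(exp (-y / ε) * ε⁻¹)) Set.univ y := fun y _ => by
    have := ((hasDerivAt_neg y).div_const ε).exp
    refine (this.congr_deriv ?_).hasDerivWithinAt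
    ring
  have hinj : Set.InjOn (fun y => exp (-y / ε)) Set.univ := fun x _ y _ hxy => by
    have := exp_injective hxy
    field_simp at this
    linarith
  rw [← himg, lintegral_image_eq_lintegral_abs_deriv_mul MeasurableSet.univ hd hinj,
    Measure.restrict_univ]
  refine lintegral_congr fun y => ?_
  rw [abs_neg, abs_of_pos (by positivity)]

theorem lintegral_hardyProfile {p b α ε : ℝ} (hp : 0 < p) (hε : 0 < ε) (φ : ℝ → ℝ) :
    ∫⁻ σ in Set.Ioi (0 : ℝ), ENNReal.ofReal
        (|hardyProfile ((b - 1) / p) ε φ σ| ^ p * exp (-α * σ) * σ ^ (-b)) =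
      ∫⁻ y, ENNReal.ofReal (ε⁻¹ * (|φ y| ^ p * exp (-α * exp (-y / ε)))) := by
  rw [lintegral_Ioi_eq_lintegral_exp hε]
  refine lintegral_congr fun y => ?_
  have h : 0 < exp (-y / ε) := exp_pos _
  rw [← ENNReal.ofReal_mul (by positivity), hardyProfile_exp hε, abs_mul,
    abs_of_nonneg (Real.rpow_nonneg h.le _), Real.mul_rpow (Real.rpow_nonneg h.le _) (abs_nonneg _),
    ← Real.rpow_mul h.le, div_mul_cancel₀ _ hp.ne']
  have e : exp (-y / ε) * exp (-y / ε) ^ (b - 1) * exp (-y / ε) ^ (-b) = 1 := by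
    rw [mul_comm (exp (-y / ε)), ← Real.rpow_add_one h.ne', ← Real.rpow_add h]
    simp
  congr 1
  linear_combination (ε⁻¹ * (|φ y| ^ p * exp (-α * exp (-y / ε)))) * e

theorem lintegral_deriv_hardyProfile {p b α ε : ℝ} (hp : 0 < p) (hε : 0 < ε) {φ : ℝ → ℝ}
    (hφ : Differentiable ℝ φ) :
    ∫⁻ σ in Set.Ioi (0 : ℝ), ENNReal.ofReal
        (|deriv (hardyProfile ((b - 1) / p) ε φ) σ| ^ p * exp (-α * σ) * σ ^ (p - b)) =
      ∫⁻ y, ENNReal.ofReal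
        (ε⁻¹ * (|(b - 1) / p * φ y - ε * deriv φ y| ^ p * exp (-α * exp (-y / ε)))) := by
  rw [lintegral_Ioi_eq_lintegral_exp hε]
  refine lintegral_congr fun y => ?_
  have h : 0 < exp (-y / ε) := exp_pos _
  rw [← ENNReal.ofReal_mul (by positivity), deriv_hardyProfile_exp hε hφ, abs_mul,
    abs_of_nonneg (Real.rpow_nonneg h.le _), Real.mul_rpow (Real.rpow_nonneg h.le _) (abs_nonneg _),
    ← Real.rpow_mul h.le, sub_mul, div_mul_cancel₀ _ hp.ne', one_mul]
  have e : exp (-y / ε) * exp (-y / ε) ^ (b - 1 - p) * exp (-y / ε) ^ (p - b) = 1 := by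
    rw [mul_comm (exp (-y / ε)), ← Real.rpow_add_one h.ne', ← Real.rpow_add h,
      show b - 1 - p + 1 + (p - b) = 0 by ring, Real.rpow_zero]
  congr 1
  linear_combination
    (ε⁻¹ * (|(b - 1) / p * φ y - ε * deriv φ y| ^ p * exp (-α * exp (-y / ε)))) * e

/-- Passage to the limit `ε → 0` in the family of almost-extremal profiles. -/
theorem tendsto_integral_profile {c p α : ℝ} (hp : 0 < p) (hα : 0 ≤ α) {φ ζ : ℝ → ℝ}
    (hφ : Continuous φ) (hζ : Continuous ζ) (hφc : HasCompactSupport φ)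
    (hζc : HasCompactSupport ζ) (hφ0 : ∀ y ≤ 0, φ y = 0) (hζ0 : ∀ y ≤ 0, ζ y = 0) :
    Filter.Tendsto (fun ε => ∫ y, |c * φ y - ε * ζ y| ^ p * exp (-α * exp (-y / ε)))
      (nhdsWithin 0 (Set.Ioi 0)) (nhds (∫ y, |c * φ y| ^ p)) := by
  have hbound : Integrable fun y => (|c * φ y| + |ζ y|) ^ p := by
    refine Continuous.integrable_of_hasCompactSupport ?_ ?_
    · exact Continuous.rpow_const (by fun_prop) fun _ => Or.inr hp.le
    · have h1 : HasCompactSupport fun y => |c * φ y| + |ζ y| :=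
        (hφc.comp_left (g := fun x => |c * x|) (by simp)).add
          (hζc.comp_left (g := fun x => |x|) (by simp))
      exact h1.comp_left (g := fun x => x ^ p) (Real.zero_rpow hp.ne')
  refine tendsto_integral_filter_of_dominated_convergence _ ?_ ?_ hbound ?_
  · filter_upwards with ε
    refine Continuous.aestronglyMeasurable (Continuous.mul ?_ (by fun_prop))
    exact Continuous.rpow_const (by fun_prop) fun _ => Or.inr hp.le
  · filter_upwards [Ioo_mem_nhdsGT (zero_lt_one' ℝ)] with ε hε
    filter_upwards with y
    have h1 : exp (-α * exp (-y / ε)) ≤ 1 := by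
      rw [Real.exp_le_one_iff]
      nlinarith [exp_pos (-y / ε)]
    have h2 : |c * φ y - ε * ζ y| ≤ |c * φ y| + |ζ y| := by
      refine (abs_sub _ _).trans ?_
      rw [abs_mul ε, abs_of_pos hε.1]
      nlinarith [abs_nonneg (ζ y), hε.2]
    rw [Real.norm_eq_abs, abs_of_nonneg (by positivity)]
    calc _ ≤ |c * φ y - ε * ζ y| ^ p * 1 := by gcongr
      _ ≤ _ := by rw [mul_one]; gcongr
  · filter_upwards with y
    rcases le_or_gt y 0 with hy | hy
    · simp [hφ0 y hy, hζ0 y hy, Real.zero_rpow hp.ne']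
    have h1 : Filter.Tendsto (fun ε : ℝ => exp (-y / ε)) (nhdsWithin 0 (Set.Ioi 0)) (nhds 0) := by
      refine Real.tendsto_exp_atBot.comp ?_
      exact (tendsto_inv_nhdsGT_zero.const_mul_atTop_of_neg (neg_neg_of_pos hy)).congr
        fun ε => (div_eq_mul_inv _ _).symm
    have h2 : Filter.Tendsto (fun ε : ℝ => exp (-α * exp (-y / ε))) (nhdsWithin 0 (Set.Ioi 0))
        (nhds 1) := by
      have := (Real.continuous_exp.tendsto _).comp (h1.const_mul (-α))
      rwa [mul_zero, exp_zero] at this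
    have h3 : Filter.Tendsto (fun ε : ℝ => |c * φ y - ε * ζ y| ^ p) (nhdsWithin 0 (Set.Ioi 0))
        (nhds (|c * φ y| ^ p)) := by
      have hc : Continuous fun ε : ℝ => |c * φ y - ε * ζ y| ^ p :=
        Continuous.rpow_const (by fun_prop) fun _ => Or.inr hp.le
      simpa using (hc.tendsto 0).mono_left nhdsWithin_le_nhds
    simpa using h3.mul h2

theorem le_of_forall_profile {c p α κ : ℝ} (hp : 0 < p) (hc : 0 < c) (hα : 0 ≤ α) {φ : ℝ → ℝ}
    (hφ : ContDiff ℝ (⊤ : ℕ∞) φ) (hφc : HasCompactSupport φ) (hφ0 : ∀ y ≤ 1, φ y = 0)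
    (hne : φ ≠ 0)
    (h : ∀ ε, 0 < ε → κ * ∫ y, |φ y| ^ p * exp (-α * exp (-y / ε)) ≤
      ∫ y, |c * φ y - ε * deriv φ y| ^ p * exp (-α * exp (-y / ε))) : κ ≤ c ^ p := by
  have hd0 : ∀ y ≤ 0, deriv φ y = 0 := fun y hy => by
    have : φ =ᶠ[nhds y] fun _ => 0 := by
      filter_upwards [Iio_mem_nhds (hy.trans_lt zero_lt_one)] with s hs
      exact hφ0 s (le_of_lt hs)
    rw [this.deriv_eq, deriv_const]
  have h0 : ∀ y ≤ 0, φ y = 0 := fun y hy => hφ0 y (by linarith)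
  have t1 := tendsto_integral_profile (c := c) hp hα hφ.continuous (hφ.continuous_deriv (by simp))
    hφc hφc.deriv h0 hd0
  have t2 := tendsto_integral_profile (c := 1) (ζ := fun _ => 0) hp hα hφ.continuous
    continuous_const hφc (HasCompactSupport.zero) h0 fun _ _ => rfl
  simp only [mul_zero, sub_zero, one_mul] at t2
  have hle := le_of_tendsto_of_tendsto (t2.const_mul κ) t1
    (Filter.eventually_of_mem self_mem_nhdsWithin fun ε hε => h ε hε)
  obtain ⟨y₀, hy₀⟩ := Function.ne_iff.1 hne
  have hpos : 0 < ∫ y, |φ y| ^ p := by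
    refine Continuous.integral_pos_of_hasCompactSupport_nonneg_nonzero
      (hφ.continuous.abs.rpow_const fun _ => Or.inr hp.le) ?_ (fun y => by positivity)
      (x := y₀) (Real.rpow_pos_of_pos (abs_pos.2 hy₀) p).ne'
    exact hφc.comp_left (g := fun x => |x| ^ p) (by simp [Real.zero_rpow hp.ne'])
  have he : ∫ y, |c * φ y| ^ p = c ^ p * ∫ y, |φ y| ^ p := by
    rw [← integral_const_mul]
    congr 1
    funext y
    rw [abs_mul, abs_of_pos hc, Real.mul_rpow hc.le (abs_nonneg _)]
  rw [he] at hle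
  exact le_of_mul_le_mul_right hle hpos

theorem toReal_lintegral_ofReal_const_mul {ε : ℝ} {f : ℝ → ℝ} (hε : 0 < ε) (hf : Continuous f)
    (h0 : ∀ y, 0 ≤ f y) : (∫⁻ y, ENNReal.ofReal (ε⁻¹ * f y)).toReal = ε⁻¹ * ∫ y, f y := by
  rw [← integral_const_mul, integral_eq_lintegral_of_nonneg_ae]
  · exact Filter.Eventually.of_forall fun y => mul_nonneg (by positivity) (h0 y)
  · exact (continuous_const.mul hf).aestronglyMeasurable

/-- The constant in the critical weighted Hardy inequality cannot be improved. -/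
theorem hardy_const_le {n : ℕ} {Q R p a b κ : ℝ} (hn : n ≠ 0) (hQ : Q = n + 2) (hR : 0 < R)
    (hp : 1 < p) (hpb : p ≤ b) (ha : a ≤ Q)
    (h : ∀ u : GPt n → ℝ, IsTest {z : GPt n | gNorm z < R} u →
      κ * ∫ z in {z : GPt n | gNorm z < R}, |u z| ^ p * gPsi z ^ (p / 2) /
          (gNorm z ^ a * log (R / gNorm z) ^ b) ≤
        ∫ z in {z : GPt n | gNorm z < R}, gPsi z ^ (p / 2) * |radialDeriv u z| ^ p /
          (gNorm z ^ (a - p) * log (R / gNorm z) ^ (b - p))) :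
    κ ≤ ((b - 1) / p) ^ p := by
  have hp0 : 0 < p := by linarith
  let φ : ContDiffBump (2 : ℝ) := ⟨1 / 2, 1, by norm_num, by norm_num⟩
  have hφ : ContDiff ℝ (⊤ : ℕ∞) φ := φ.contDiff
  have hA : ∀ y ≤ 1, φ y = 0 := fun y hy => φ.zero_of_le_dist (by
    rw [Real.dist_eq, abs_of_nonpos (by linarith)]
    change 1 ≤ _
    linarith)
  have hB : ∀ y, 3 ≤ y → φ y = 0 := fun y hy => φ.zero_of_le_dist (by
    rw [Real.dist_eq, abs_of_nonneg (by linarith)]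
    change 1 ≤ _
    linarith)
  have hne : (φ : ℝ → ℝ) ≠ 0 :=
    Function.ne_iff.2 ⟨2, (φ.pos_of_mem_ball (Metric.mem_ball_self φ.rOut_pos)).ne'⟩
  refine le_of_forall_profile hp0 (div_pos (by linarith) hp0) (sub_nonneg.2 ha) hφ
    φ.hasCompactSupport hA hne fun ε hε => ?_
  set c := (b - 1) / p with hc
  have hsmooth := contDiff_hardyProfile (c := c) hε hφ hA hB
  have hu : IsTest {z : GPt n | gNorm z < R} (gRadial n R (hardyProfile c ε φ)) :=
    isTest_gRadial hR (exp_pos (-3 / ε)) hsmooth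
      (fun s hs => hardyProfile_eq_zero hε hA hB (Or.inl hs))
      (fun s hs => hardyProfile_eq_zero hε hA hB (Or.inr hs))
  have key := h _ hu
  have orb : ∀ G : (ℝ → ℝ) → ENNReal,
      ∫⁻ w in gShell n, gAngular R p (Q - a) w *
        G (gOrbit R (gRadial n R (hardyProfile c ε φ)) w) =
      (∫⁻ w in gShell n, gAngular R p (Q - a) w) * G (hardyProfile c ε φ) := fun G => by
    rw [← lintegral_mul_const _ measurable_gAngular]
    refine setLIntegral_congr_fun (measurableSet_gShell n) fun w hw => ?_
    simp only [gOrbit_gRadial hR _ (gNorm_pos_of_mem_gShell hw)]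
  rw [integral_hardy_right hu.1, integral_hardy_left hu.1, lintegral_hardy_right hQ hR rfl hu.1,
    lintegral_hardy_left hQ hR rfl hu.1,
    orb fun k => ∫⁻ σ in Set.Ioi (0 : ℝ),
      ENNReal.ofReal (|k σ| ^ p * exp (-(Q - a) * σ) * σ ^ (-b)),
    orb fun k => ∫⁻ σ in Set.Ioi (0 : ℝ),
      ENNReal.ofReal (|deriv k σ| ^ p * exp (-(Q - a) * σ) * σ ^ (p - b)),
    lintegral_hardyProfile hp0 hε, lintegral_deriv_hardyProfile hp0 hε
      (hφ.differentiable (by simp)), ENNReal.toReal_mul, ENNReal.toReal_mul,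
    toReal_lintegral_ofReal_const_mul hε, toReal_lintegral_ofReal_const_mul hε] at key
  · have hK : 0 < (∫⁻ w in gShell n, gAngular R p (Q - a) w).toReal :=
      ENNReal.toReal_pos (lintegral_gAngular_pos hn hR).ne'
        (lintegral_gAngular_lt_top hp0.le hR).ne
    refine le_of_mul_le_mul_left ?_ (mul_pos hK (inv_pos.2 hε))
    linarith
  · refine Continuous.mul (Continuous.rpow_const ?_ fun _ => Or.inr hp0.le) (by fun_prop)
    exact ((continuous_const.mul hφ.continuous).sub
      (continuous_const.mul (hφ.continuous_deriv (by simp)))).abs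
  · intro y; positivity
  · exact (hφ.continuous.abs.rpow_const fun _ => Or.inr hp0.le).mul (by fun_prop)
  · intro y; positivity


/-- critical weighted Hardy inequality with logarithmic weights on the gauge
ball, with sharp constant `((b−1)/p)^p` (Corollary 3.3 of the paper). -/
theorem critical_weighted_hardy
    (n : ℕ) (Q : ℝ) (hQ : Q = n + 2) (hQ4 : 4 ≤ Q) (R : ℝ) (hR : 0 < R)
    (p a b : ℝ) (hp : 1 < p) (hpb : p ≤ b) (ha : a ≤ Q) :
    (∀ u : GPt n → ℝ, IsTest {z : GPt n | gNorm z < R} u →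
      (∫ z in {z : GPt n | gNorm z < R},
          gPsi z ^ (p / 2) * |radialDeriv u z| ^ p /
            (gNorm z ^ (a - p) * Real.log (R / gNorm z) ^ (b - p)))
        ≥ ((b - 1) / p) ^ p *
            ∫ z in {z : GPt n | gNorm z < R},
              |u z| ^ p * gPsi z ^ (p / 2) /
                (gNorm z ^ a * Real.log (R / gNorm z) ^ b))
    ∧ ∀ κ : ℝ,
        (∀ u : GPt n → ℝ, IsTest {z : GPt n | gNorm z < R} u →
          (∫ z in {z : GPt n | gNorm z < R},
              gPsi z ^ (p / 2) * |radialDeriv u z| ^ p /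
                (gNorm z ^ (a - p) * Real.log (R / gNorm z) ^ (b - p)))
            ≥ κ *
                ∫ z in {z : GPt n | gNorm z < R},
                  |u z| ^ p * gPsi z ^ (p / 2) /
                    (gNorm z ^ a * Real.log (R / gNorm z) ^ b)) →
        κ ≤ ((b - 1) / p) ^ p := by
  have hn : n ≠ 0 := by
    rintro rfl
    norm_num at hQ
    linarith
  exact ⟨fun u hu => integral_hardy_le hQ hR hp hpb ha hu,
    fun κ h => hardy_const_le hn hQ hR hp hpb ha h⟩
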